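/- Let f be a real-valued function defined in a neighborhood of 0 that is continuous at 0 with |f(0)| < 1, and let t > 0 be a constant with |f(0)|·e^t < 1. Then there exists ε₀ > 0 such that for all ε ∈ [−ε₀, ε₀], the anisotropic circuit model on ℤ² with weights w(γ) = ε^{N_h(γ)} · f(ε)^{N_v(γ)} satisfies the Kotecký–Preiss criterion with a(γ) := t·(N_h(γ) + N_v(γ)): for every circuit γ* on ℤ², the sum over all circuits γ on ℤ² that share at least one edge with γ* of |ε|^{N_h(γ)} · |f(ε)|^{N_v(γ)} · e^{t·(N_h(γ)+N_v(γ))} is at most t·(N_h(γ*) + N_v(γ*)). -/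

import Mathlib

open scoped BigOperators

def sqStep : Fin 4 → ℤ × ℤ
  | 0 => (1, 0)
  | 1 => (-1, 0)
  | 2 => (0, 1)
  | 3 => (0, -1)

/-- Position of the walk after `i` steps, starting at the origin. -/
def sqPos {n : ℕ} (ω : Fin n → Fin 4) (i : Fin (n + 1)) : ℤ × ℤ :=
  ∑ j : Fin n, if (j : ℕ) < (i : ℕ) then sqStep (ω j) else 0

/-- A walk is a self-avoiding trail if its undirected edges are pairwise distinct. -/
def sqIsSAT {n : ℕ} (ω : Fin n → Fin 4) : Prop :=
  Function.Injective (fun i : Fin n => s(sqPos ω i.castSucc, sqPos ω i.succ))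

/-- Number of horizontal steps. -/
def sqNh {n : ℕ} (ω : Fin n → Fin 4) : ℕ :=
  (Finset.univ.filter fun j => ω j = 0 ∨ ω j = 1).card

/-- Number of vertical steps. -/
def sqNv {n : ℕ} (ω : Fin n → Fin 4) : ℕ :=
  (Finset.univ.filter fun j => ω j = 2 ∨ ω j = 3).card

/-- A circuit on `ℤ²`: a self-avoiding trail of positive length whose
endpoints coincide, anchored at an arbitrary starting vertex. -/
structure SqCircuit where
  len : ℕ
  len_pos : 1 ≤ len
  start : ℤ × ℤ
  steps : Fin len → Fin 4
  trail : Function.Injective fun i : Fin len =>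
    s(start + sqPos steps i.castSucc, start + sqPos steps i.succ)
  closed : sqPos steps (Fin.last len) = sqPos steps 0

/-- The set of undirected edges traversed by a circuit. -/
def SqCircuit.edges (γ : SqCircuit) : Set (Sym2 (ℤ × ℤ)) :=
  Set.range fun i : Fin γ.len =>
    s(γ.start + sqPos γ.steps i.castSucc, γ.start + sqPos γ.steps i.succ)

lemma sqPos_zero {n : ℕ} (ω : Fin n → Fin 4) : sqPos ω 0 = 0 := by
  simp [sqPos]

lemma sqPos_succ {n : ℕ} (ω : Fin n → Fin 4) (i : Fin n) :
    sqPos ω i.succ = sqPos ω i.castSucc + sqStep (ω i) := by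
  have h : sqStep (ω i) = ∑ j : Fin n, if j = i then sqStep (ω j) else 0 := by simp
  rw [h]
  unfold sqPos
  rw [← Finset.sum_add_distrib]
  refine Finset.sum_congr rfl fun j _ => ?_
  simp only [Fin.val_succ, Fin.val_castSucc, Fin.ext_iff]
  rcases lt_trichotomy (j : ℕ) i with hj | hj | hj
  · simp [hj, hj.ne, hj.trans (Nat.lt_succ_self _)]
  · simp [hj]
  · simp [hj.ne', not_lt.2 hj.le, not_lt.2 (Nat.succ_le_of_lt hj)]

lemma sqNh_add_sqNv {n : ℕ} (ω : Fin n → Fin 4) : sqNh ω + sqNv ω = n := by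
  unfold sqNh sqNv
  rw [← Finset.card_union_of_disjoint, ← Finset.filter_or, Finset.filter_true_of_mem]
  · simp
  · intro j _
    generalize ω j = a
    revert a
    decide
  · rw [Finset.disjoint_filter]
    intro j _
    generalize ω j = a
    revert a
    decide

/-- A vertical step followed by the opposite vertical step. -/
def VertBacktrack (a b : Fin 4) : Prop := (a = 2 ∧ b = 3) ∨ (a = 3 ∧ b = 2)

instance : DecidableRel VertBacktrack := fun a b => by
  unfold VertBacktrack
  infer_instance

/-- The weight of a step: `z` if it is horizontal, `q` if it is vertical. -/
def stepWeight (z q : ℝ) (a : Fin 4) : ℝ := if a = 0 ∨ a = 1 then z else q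

/-- The weight of a step `b` following a step `a`, killing vertical backtracks. -/
def transferWeight (z q : ℝ) (a b : Fin 4) : ℝ := if VertBacktrack a b then 0 else stepWeight z q b

/-- The weight of a walk `ω` entered by a step `c`, killing vertical backtracks. -/
def walkWeight (z q : ℝ) {n : ℕ} (c : Fin 4) (ω : Fin n → Fin 4) : ℝ :=
  ∏ i : Fin n, transferWeight z q (Fin.cons (α := fun _ => Fin 4) c ω i.castSucc) (ω i)

lemma transferWeight_nonneg {z q : ℝ} (hz : 0 ≤ z) (hq : 0 ≤ q) (a b : Fin 4) :
    0 ≤ transferWeight z q a b := by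
  unfold transferWeight stepWeight
  split_ifs <;> simp [hz, hq]

lemma walkWeight_nonneg {z q : ℝ} (hz : 0 ≤ z) (hq : 0 ≤ q) {n : ℕ} (c : Fin 4)
    (ω : Fin n → Fin 4) : 0 ≤ walkWeight z q c ω :=
  Finset.prod_nonneg fun _ _ => transferWeight_nonneg hz hq _ _

lemma walkWeight_cons (z q : ℝ) {n : ℕ} (c d : Fin 4) (ω : Fin n → Fin 4) :
    walkWeight z q c (Fin.cons (α := fun _ => Fin 4) d ω : Fin (n + 1) → Fin 4) =
      transferWeight z q c d * walkWeight z q d ω := by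
  unfold walkWeight
  rw [Fin.prod_univ_succ]
  simp

lemma prod_stepWeight (z q : ℝ) {n : ℕ} (ω : Fin n → Fin 4) :
    ∏ i, stepWeight z q (ω i) = z ^ sqNh ω * q ^ sqNv ω := by
  unfold stepWeight sqNh sqNv
  rw [Finset.prod_ite, Finset.prod_const, Finset.prod_const]
  congr 3
  refine Finset.filter_congr fun j _ => ?_
  generalize ω j = a
  revert a
  decide

lemma walkWeight_of_not_vertBacktrack (z q : ℝ) {n : ℕ} (ω : Fin n → Fin 4)
    (h : ∀ i j : Fin n, (j : ℕ) = i + 1 → ¬ VertBacktrack (ω i) (ω j)) :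
    walkWeight z q 0 ω = z ^ sqNh ω * q ^ sqNv ω := by
  rw [← prod_stepWeight]
  refine Finset.prod_congr rfl fun i _ => if_neg ?_
  cases n with
  | zero => exact i.elim0
  | succ n =>
    induction i using Fin.cases with
    | zero => simp [VertBacktrack]
    | succ i =>
      rw [← Fin.succ_castSucc, Fin.cons_succ]
      exact h _ _ (by simp)

lemma sum_transferWeight_mul_le {q : ℝ} (hq0 : 0 ≤ q) (c : Fin 4) :
    ∑ d, transferWeight ((1 - q) / 16) q c d * stepWeight 4 1 d ≤
      (1 + q) / 2 * stepWeight 4 1 c := by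
  fin_cases c <;>
    simp [Fin.sum_univ_four, transferWeight, stepWeight, VertBacktrack] <;> linarith

lemma sum_walkWeight_le {q : ℝ} (hq0 : 0 ≤ q) (hq1 : q < 1) (n : ℕ) (c : Fin 4) :
    ∑ ω : Fin n → Fin 4, walkWeight ((1 - q) / 16) q c ω ≤
      ((1 + q) / 2) ^ n * stepWeight 4 1 c := by
  induction n generalizing c with
  | zero =>
    simp only [walkWeight, Finset.univ_eq_empty, Finset.prod_empty, stepWeight]
    split_ifs <;> simp
  | succ n ih =>
    rw [← (Fin.consEquiv fun _ : Fin (n + 1) => Fin 4).sum_comp, Fintype.sum_prod_type]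
    calc _ = ∑ d, transferWeight ((1 - q) / 16) q c d *
            ∑ ω : Fin n → Fin 4, walkWeight ((1 - q) / 16) q d ω := by
          refine Finset.sum_congr rfl fun d _ => ?_
          rw [Finset.mul_sum]
          exact Finset.sum_congr rfl fun ω _ => walkWeight_cons _ _ _ _ _
      _ ≤ ∑ d, transferWeight ((1 - q) / 16) q c d *
            (((1 + q) / 2) ^ n * stepWeight 4 1 d) :=
          Finset.sum_le_sum fun d _ => mul_le_mul_of_nonneg_left (ih d)
            (transferWeight_nonneg (by linarith) hq0 _ _)
      _ = ((1 + q) / 2) ^ n * ∑ d, transferWeight ((1 - q) / 16) q c d * stepWeight 4 1 d := by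
          rw [Finset.mul_sum]
          exact Finset.sum_congr rfl fun d _ => by ring
      _ ≤ ((1 + q) / 2) ^ n * ((1 + q) / 2 * stepWeight 4 1 c) :=
          mul_le_mul_of_nonneg_left (sum_transferWeight_mul_le hq0 c) (by positivity)
      _ = _ := by ring

namespace SqCircuit

lemma not_vertBacktrack (γ : SqCircuit) (i j : Fin γ.len) (hij : (j : ℕ) = i + 1) :
    ¬ VertBacktrack (γ.steps i) (γ.steps j) := by
  intro h
  have hj : j.castSucc = i.succ := Fin.ext (by simp [hij])
  have hstep : sqStep (γ.steps i) + sqStep (γ.steps j) = 0 := by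
    rcases h with ⟨h₁, h₂⟩ | ⟨h₁, h₂⟩ <;> rw [h₁, h₂] <;> simp [sqStep]
  have hpos : sqPos γ.steps j.succ = sqPos γ.steps i.castSucc := by
    rw [sqPos_succ, hj, sqPos_succ, add_assoc, hstep, add_zero]
  have : i = j := by
    apply γ.trail
    simp only [hpos, hj]
    exact Sym2.eq_swap
  omega

lemma one_le_sqNh (γ : SqCircuit) : 1 ≤ sqNh γ.steps := by
  by_contra! h
  have hvert : ∀ j, γ.steps j ≠ 0 ∧ γ.steps j ≠ 1 := by
    intro j
    rw [Nat.lt_one_iff, sqNh, Finset.card_eq_zero, Finset.filter_eq_empty_iff] at h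
    simpa [not_or] using h (Finset.mem_univ j)
  have hpos := γ.len_pos
  have hconst : ∀ k (hk : k < γ.len), γ.steps ⟨k, hk⟩ = γ.steps ⟨0, hpos⟩ := by
    intro k
    induction k with
    | zero => exact fun _ => rfl
    | succ k ih =>
      intro hk
      rw [← ih (by omega)]
      have h₁ := hvert ⟨k + 1, hk⟩
      have h₂ := hvert ⟨k, by omega⟩
      have h₃ := γ.not_vertBacktrack ⟨k, by omega⟩ ⟨k + 1, hk⟩ rfl
      revert h₁ h₂ h₃
      generalize γ.steps ⟨k + 1, hk⟩ = a
      generalize γ.steps ⟨k, _⟩ = b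
      revert a b
      decide
  have hlast : sqPos γ.steps (Fin.last γ.len) = γ.len • sqStep (γ.steps ⟨0, hpos⟩) := by
    simp only [sqPos, Fin.val_last, Fin.is_lt, if_true]
    rw [Finset.sum_congr rfl fun j _ => by rw [hconst j j.2]]
    simp
  rw [γ.closed, sqPos_zero, eq_comm, smul_eq_zero] at hlast
  rcases hlast with hlast | hlast
  · omega
  · revert hlast
    generalize γ.steps _ = a
    revert a
    decide

/-- A circuit meeting `γs` is determined by its step sequence, the position of a common edge in
both circuits, and the relative orientation of this edge. -/
lemma exists_code (γs : SqCircuit) : ∃ Φ : {γ : SqCircuit // (γ.edges ∩ γs.edges).Nonempty} →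
    (Fin γs.len × Bool) × (Σ n : ℕ, (Fin n → Fin 4) × Fin n), Function.Injective Φ ∧
      ∀ γ, ∃ j, (Φ γ).2 = ⟨γ.1.len, γ.1.steps, j⟩ := by
  let v (p : Fin γs.len × Bool) : ℤ × ℤ :=
    γs.start + if p.2 then sqPos γs.steps p.1.castSucc else sqPos γs.steps p.1.succ
  have key : ∀ γ : {γ : SqCircuit // (γ.edges ∩ γs.edges).Nonempty},
      ∃ p : Fin γs.len × Bool, ∃ j : Fin γ.1.len,
        γ.1.start + sqPos γ.1.steps j.castSucc = v p := by
    rintro ⟨γ, e, ⟨j, hj⟩, ⟨i, hi⟩⟩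
    have h := hj.trans hi.symm
    simp only [Sym2.eq_iff] at h
    rcases h with h | h
    · exact ⟨(i, true), j, h.1⟩
    · exact ⟨(i, false), j, h.1⟩
  choose p j h using key
  refine ⟨fun γ => (p γ, ⟨γ.1.len, γ.1.steps, j γ⟩), ?_, fun γ => ⟨j γ, rfl⟩⟩
  intro γ γ' heq
  have hp : p γ = p γ' := congrArg Prod.fst heq
  have hs := congrArg Prod.snd heq
  dsimp only at hs
  have h₁ := h γ
  have h₂ := h γ'
  rw [← hp, ← h₁] at h₂
  clear heq hp h₁
  revert hs h₂
  generalize j γ = k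
  generalize j γ' = k'
  obtain ⟨⟨n, _, s, ω, _, _⟩, _⟩ := γ
  obtain ⟨⟨n', _, s', ω', _, _⟩, _⟩ := γ'
  intro hs h₂
  dsimp only at k k' hs h₂
  cases hs
  have := add_right_cancel h₂
  subst this
  rfl

lemma weight_le (γ : SqCircuit) {x y z q δ : ℝ} (hx : 0 ≤ x) (hy : 0 ≤ y) (hz : 0 ≤ z)
    (hδ : 0 ≤ δ) (hδ1 : δ ≤ 1) (hxz : x ≤ δ * z) (hyq : y ≤ q) :
    x ^ sqNh γ.steps * y ^ sqNv γ.steps ≤ δ * walkWeight z q 0 γ.steps := by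
  rw [walkWeight_of_not_vertBacktrack _ _ _ γ.not_vertBacktrack, ← mul_assoc]
  have hδh : δ ^ sqNh γ.steps ≤ δ :=
    pow_le_of_le_one hδ hδ1 (Nat.one_le_iff_ne_zero.1 γ.one_le_sqNh)
  refine mul_le_mul ?_ (pow_le_pow_left₀ hy hyq _) (by positivity) (by positivity)
  calc x ^ sqNh γ.steps ≤ (δ * z) ^ sqNh γ.steps := pow_le_pow_left₀ hx hxz _
    _ = δ ^ sqNh γ.steps * z ^ sqNh γ.steps := mul_pow _ _ _
    _ ≤ δ * z ^ sqNh γ.steps := mul_le_mul_of_nonneg_right hδh (by positivity)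

lemma tsum_weight_le (γs : SqCircuit) {x y q δ : ℝ} (hx : 0 ≤ x) (hy : 0 ≤ y)
    (hq1 : q < 1) (hδ : 0 ≤ δ) (hδ1 : δ ≤ 1) (hxz : x ≤ δ * ((1 - q) / 16)) (hyq : y ≤ q) :
    ∑' γ : {γ : SqCircuit // (γ.edges ∩ γs.edges).Nonempty},
        ENNReal.ofReal (x ^ sqNh γ.1.steps * y ^ sqNv γ.1.steps) ≤
      ENNReal.ofReal (γs.len * (8 * δ * ∑' n : ℕ, n * ((1 + q) / 2) ^ n)) := by
  have hq0 : 0 ≤ q := hy.trans hyq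
  have hz : 0 ≤ (1 - q) / 16 := by linarith
  have hsummable : Summable fun n : ℕ => (n : ℝ) * ((1 + q) / 2) ^ n := by
    have := summable_pow_mul_geometric_of_norm_lt_one (R := ℝ) 1 (r := (1 + q) / 2)
      (by rw [Real.norm_of_nonneg (by linarith)]; linarith)
    simpa using this
  obtain ⟨Φ, hΦ, hcode⟩ := γs.exists_code
  let g : (Σ n : ℕ, (Fin n → Fin 4) × Fin n) → ENNReal :=
    fun s => ENNReal.ofReal (δ * walkWeight ((1 - q) / 16) q 0 s.2.1)
  calc _ ≤ ∑' γ, g (Φ γ).2 := by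
        refine ENNReal.tsum_le_tsum fun γ => ?_
        obtain ⟨j, hj⟩ := hcode γ
        rw [hj]
        exact ENNReal.ofReal_le_ofReal (γ.1.weight_le hx hy hz hδ hδ1 hxz hyq)
    _ ≤ ∑' p : (Fin γs.len × Bool) × (Σ n : ℕ, (Fin n → Fin 4) × Fin n), g p.2 :=
        ENNReal.tsum_comp_le_tsum_of_injective hΦ fun p => g p.2
    _ = (γs.len * 2 : ℕ) * ∑' n : ℕ, n * ENNReal.ofReal
          (δ * ∑ ω : Fin n → Fin 4, walkWeight ((1 - q) / 16) q 0 ω) := by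
        rw [ENNReal.tsum_prod (f := fun _ s => g s)]
        simp only [g, tsum_fintype, Finset.sum_const, nsmul_eq_mul, Finset.card_univ,
          Fintype.card_prod, Fintype.card_fin, Fintype.card_bool]
        rw [ENNReal.tsum_sigma']
        congr 2
        funext n
        rw [tsum_fintype, Fintype.sum_prod_type, Finset.mul_sum,
          ENNReal.ofReal_sum_of_nonneg fun ω _ => mul_nonneg hδ (walkWeight_nonneg hz hq0 _ _),
          Finset.mul_sum]
        simp
    _ ≤ (γs.len * 2 : ℕ) * ∑' n : ℕ, ENNReal.ofReal (4 * δ * (n * ((1 + q) / 2) ^ n)) := by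
        gcongr with n
        rw [← ENNReal.ofReal_natCast n, ← ENNReal.ofReal_mul (Nat.cast_nonneg n)]
        refine ENNReal.ofReal_le_ofReal ?_
        have h := sum_walkWeight_le hq0 hq1 n 0
        simp only [stepWeight, true_or, if_true] at h
        calc _ ≤ (n : ℝ) * (δ * (((1 + q) / 2) ^ n * 4)) := by gcongr
          _ = _ := by ring
    _ = _ := by
        rw [← ENNReal.ofReal_tsum_of_nonneg (fun n => by positivity) (hsummable.mul_left _),
          tsum_mul_left, ← ENNReal.ofReal_natCast, ← ENNReal.ofReal_mul (Nat.cast_nonneg _)]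
        push_cast
        ring_nf

end SqCircuit

/-- The Kotecký–Preiss criterion for the anisotropic circuit model on `ℤ²` with weights
`w(γ) = ε^{N_h(γ)} f(ε)^{N_v(γ)}` and `a(γ) = t (N_h(γ) + N_v(γ))`. -/
theorem circuit_model_kotecky_preiss (f : ℝ → ℝ) (hf : ContinuousAt f 0) (hf0 : |f 0| < 1)
    (t : ℝ) (ht : 0 < t) (ht' : |f 0| * Real.exp t < 1) :
    ∃ ε₀ > 0, ∀ ε : ℝ, ε ∈ Set.Icc (-ε₀) ε₀ → ∀ γs : SqCircuit,
      (Summable fun γ : {γ : SqCircuit // (γ.edges ∩ γs.edges).Nonempty} =>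
        |ε| ^ sqNh γ.1.steps * |f ε| ^ sqNv γ.1.steps *
          Real.exp (t * ((sqNh γ.1.steps : ℝ) + (sqNv γ.1.steps : ℝ)))) ∧
      (∑' γ : {γ : SqCircuit // (γ.edges ∩ γs.edges).Nonempty},
        |ε| ^ sqNh γ.1.steps * |f ε| ^ sqNv γ.1.steps *
          Real.exp (t * ((sqNh γ.1.steps : ℝ) + (sqNv γ.1.steps : ℝ))))
        ≤ t * ((sqNh γs.steps : ℝ) + (sqNv γs.steps : ℝ)) := by
  have hexp := Real.exp_pos t
  obtain ⟨q, hq, hq1⟩ := exists_between ht'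
  have hq0 : 0 < q := lt_of_le_of_lt (by positivity) hq
  set B : ℝ := ∑' n : ℕ, n * ((1 + q) / 2) ^ n with hB
  have hB0 : 0 ≤ B := tsum_nonneg fun n => by positivity
  obtain ⟨δ, hδ, hδ1, hδB⟩ : ∃ δ : ℝ, 0 < δ ∧ δ ≤ 1 ∧ 8 * δ * B ≤ t := by
    refine ⟨min 1 (t / (8 * B + 1)), by positivity, min_le_left _ _, ?_⟩
    have h := min_le_right 1 (t / (8 * B + 1))
    rw [le_div_iff₀ (by positivity)] at h
    have : 0 < min 1 (t / (8 * B + 1)) := by positivity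
    nlinarith
  have hnear : ∀ᶠ ε in nhds (0 : ℝ), |f ε| * Real.exp t < q ∧
      |ε| * Real.exp t < δ * ((1 - q) / 16) := by
    refine ((hf.abs.mul continuousAt_const).eventually_lt_const hq).and ?_
    refine (continuous_abs.mul continuous_const).continuousAt.eventually_lt_const ?_
    have : 0 < 1 - q := by linarith
    simpa using by positivity
  obtain ⟨ε₀, hε₀, hball⟩ := Metric.nhds_basis_closedBall.eventually_iff.1 hnear
  refine ⟨ε₀, hε₀, fun ε hε γs => ?_⟩
  obtain ⟨hy, hx⟩ := hball (x := ε) (by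
    rw [Real.closedBall_eq_Icc]
    simpa using hε)
  have hw : ∀ h v : ℕ, |ε| ^ h * |f ε| ^ v * Real.exp (t * ((h : ℝ) + (v : ℝ))) =
      (|ε| * Real.exp t) ^ h * (|f ε| * Real.exp t) ^ v := by
    intro h v
    rw [mul_add, Real.exp_add, mul_comm t, mul_comm t, Real.exp_nat_mul, Real.exp_nat_mul,
      mul_pow, mul_pow]
    ring
  simp only [hw]
  have hle := γs.tsum_weight_le (x := |ε| * Real.exp t) (y := |f ε| * Real.exp t)
    (by positivity) (by positivity) hq1 hδ.le hδ1 hx.le hy.le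
  rw [← hB] at hle
  have hnn : ∀ γ : {γ : SqCircuit // (γ.edges ∩ γs.edges).Nonempty},
      0 ≤ (|ε| * Real.exp t) ^ sqNh γ.1.steps * (|f ε| * Real.exp t) ^ sqNv γ.1.steps :=
    fun γ => by positivity
  have hsum : Summable fun γ : {γ : SqCircuit // (γ.edges ∩ γs.edges).Nonempty} =>
      (|ε| * Real.exp t) ^ sqNh γ.1.steps * (|f ε| * Real.exp t) ^ sqNv γ.1.steps := by
    have := ENNReal.summable_toReal (ne_top_of_le_ne_top ENNReal.ofReal_ne_top hle)
    simpa only [ENNReal.toReal_ofReal (hnn _)] using this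
  refine ⟨hsum, ?_⟩
  rw [← ENNReal.ofReal_tsum_of_nonneg hnn hsum,
    ENNReal.ofReal_le_ofReal_iff (by positivity)] at hle
  refine hle.trans ?_
  rw [← Nat.cast_add, sqNh_add_sqNv, mul_comm]
  gcongr
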